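/- arXiv:2009.03500 — 10 statements merged into one kernel-verified Lean document; each statement's English description precedes it below -/
import Mathlib

section
/- For every point p ∈ ℝ⁶ satisfying X₁ + 2X₂ + 4m·X₃ = 1, the Einstein vector field V satisfies the two identities: (i) V₁(p) + 2V₂(p) + 4m·V₃(p) = 0, i.e. V is tangent to the hyperplane {X₁ + 2X₂ + 4m·X₃ = 1}; and (ii) the directional derivative of G + R_s along V at p equals 2(G + R_s − 1)(G + L), i.e. ⟨∇(G+R_s)(p), V(p)⟩ = 2(G(p) + R_s(p) − 1)(G(p) + L(p)). -/
open Real Set Filter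

noncomputable section

/-- The quadratic form `G(p) = X₁² + 2X₂² + 4m X₃²`. -/
def G (m : ℕ) (p : Fin 6 → ℝ) : ℝ := (p 0)^2 + 2*(p 1)^2 + 4*(m:ℝ)*(p 2)^2

/-- `R₁(p) = (1/2)Y₁²Y₂² + (m/4)Y₁²Y₃²`. -/
def R1 (m : ℕ) (p : Fin 6 → ℝ) : ℝ := (1/2)*(p 3)^2*(p 4)^2 + ((m:ℝ)/4)*(p 3)^2*(p 5)^2

/-- `R₂(p) = 2Y₂² − (1/2)Y₁²Y₂² + (m/2)Y₃²`. -/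
def R2 (m : ℕ) (p : Fin 6 → ℝ) : ℝ := 2*(p 4)^2 - (1/2)*(p 3)^2*(p 4)^2 + ((m:ℝ)/2)*(p 5)^2

/-- `R₃(p) = (m+2)Y₂Y₃ − (1/8)Y₁²Y₃² − (1/2)Y₃²`. -/
def R3 (m : ℕ) (p : Fin 6 → ℝ) : ℝ :=
  ((m:ℝ)+2)*(p 4)*(p 5) - (1/8)*(p 3)^2*(p 5)^2 - (1/2)*(p 5)^2

/-- `R_s = R₁ + 2R₂ + 4m R₃`. -/
def Rs (m : ℕ) (p : Fin 6 → ℝ) : ℝ := R1 m p + 2*R2 m p + 4*(m:ℝ)*R3 m p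

/-- `L = (G + R_s − 1)/(4m+2)`. -/
def L (m : ℕ) (p : Fin 6 → ℝ) : ℝ := (G m p + Rs m p - 1)/(4*(m:ℝ)+2)

/-- The Einstein vector field. -/
def V (m : ℕ) (p : Fin 6 → ℝ) : Fin 6 → ℝ :=
  ![ p 0 * (G m p + L m p - 1) + R1 m p - L m p,
     p 1 * (G m p + L m p - 1) + R2 m p - L m p,
     p 2 * (G m p + L m p - 1) + R3 m p - L m p,
     p 3 * (p 0 - p 1),
     p 4 * (G m p + L m p - p 1),
     p 5 * (G m p + L m p + p 1 - 2*p 2) ]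

/-- `𝓔 = {p : X₁+2X₂+4m X₃ = 1 and G + R_s ≤ 1}`. -/
def setE (m : ℕ) : Set (Fin 6 → ℝ) :=
  {p | p 0 + 2*p 1 + 4*(m:ℝ)*p 2 = 1 ∧ G m p + Rs m p ≤ 1}

/-- `∂𝓔 = {p : X₁+2X₂+4m X₃ = 1 and G + R_s = 1}`. -/
def bdryE (m : ℕ) : Set (Fin 6 → ℝ) :=
  {p | p 0 + 2*p 1 + 4*(m:ℝ)*p 2 = 1 ∧ G m p + Rs m p = 1}

/-- `𝓟 = {p : Y₁ ≥ 0, Y₂ ≥ 0, Y₃ ≥ 0}`. -/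
def setP : Set (Fin 6 → ℝ) := {p | 0 ≤ p 3 ∧ 0 ≤ p 4 ∧ 0 ≤ p 5}

/-- `𝓐₁ = {p : X₁ ≤ X₂ and Y₁² ≤ 2}`. -/
def setA1 : Set (Fin 6 → ℝ) := {p | p 0 ≤ p 1 ∧ (p 3)^2 ≤ 2}

/-- `𝓐₂`. -/
def setA2 : Set (Fin 6 → ℝ) :=
  {p | 0 ≤ 2*p 4 - p 5 ∧ 0 ≤ (Real.sqrt 2/2)*(2*p 4 - p 5) + p 2 - p 1 ∧
       p 1 ≤ 1/2 ∧ 0 ≤ p 2}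

/-- The compact invariant set `𝓢`. -/
def setS (m : ℕ) : Set (Fin 6 → ℝ) := setE m ∩ setP ∩ setA1 ∩ setA2

/-- A solution of the Einstein ODE system on a set `I ⊆ ℝ`. -/
def IsSolution (m : ℕ) (I : Set ℝ) (c : ℝ → Fin 6 → ℝ) : Prop :=
  ∀ η ∈ I, HasDerivWithinAt c (V m (c η)) I η

/-- The sum `G + R_s` after cancellation in the `R_i`. -/
theorem G_add_Rs_eq (m : ℕ) (q : Fin 6 → ℝ) :
    G m q + Rs m q = (q 0)^2 + 2*(q 1)^2 + 4*(m:ℝ)*(q 2)^2 + 4*(q 4)^2 - (1/2)*((q 3)^2*(q 4)^2)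
      - ((m:ℝ)/4)*((q 3)^2*(q 5)^2) - (m:ℝ)*(q 5)^2 + 4*(m:ℝ)*((m:ℝ)+2)*(q 4*q 5) := by
  simp only [G, Rs, R1, R2, R3]
  ring

/-- The differential of `G + R_s` at `p` applied to `v`. -/
theorem fderiv_G_add_Rs_apply (m : ℕ) (p v : Fin 6 → ℝ) :
    fderiv ℝ (fun q => G m q + Rs m q) p v =
      2*p 0*v 0 + 4*p 1*v 1 + 8*(m:ℝ)*p 2*v 2 + 8*p 4*v 4
        - p 3*(p 4)^2*v 3 - (p 3)^2*p 4*v 4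
        - ((m:ℝ)/2)*(p 3*(p 5)^2*v 3 + (p 3)^2*p 5*v 5)
        - 2*(m:ℝ)*p 5*v 5 + 4*(m:ℝ)*((m:ℝ)+2)*(p 4*v 5 + p 5*v 4) := by
  have h (i : Fin 6) : HasFDerivAt (fun q : Fin 6 → ℝ => q i)
      (ContinuousLinearMap.proj (R := ℝ) (φ := fun _ : Fin 6 => ℝ) i) p := hasFDerivAt_apply i p
  have hd := ((((((((h 0).pow 2).add (((h 1).pow 2).const_mul 2)).add
    (((h 2).pow 2).const_mul (4*(m:ℝ)))).add (((h 4).pow 2).const_mul 4)).sub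
    ((((h 3).pow 2).mul ((h 4).pow 2)).const_mul (1/2))).sub
    ((((h 3).pow 2).mul ((h 5).pow 2)).const_mul ((m:ℝ)/4))).sub
    (((h 5).pow 2).const_mul (m:ℝ))).add
    (((h 4).mul (h 5)).const_mul (4*(m:ℝ)*((m:ℝ)+2)))
  rw [(hd.congr_of_eventuallyEq (.of_forall (G_add_Rs_eq m))).fderiv]
  simp
  ring

theorem stmt0 (m : ℕ) (hm : 1 ≤ m) (p : Fin 6 → ℝ)
    (hp : p 0 + 2*p 1 + 4*(m:ℝ)*p 2 = 1) :
    V m p 0 + 2 * V m p 1 + 4*(m:ℝ) * V m p 2 = 0 ∧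
    fderiv ℝ (fun q => G m q + Rs m q) p (V m p)
      = 2 * (G m p + Rs m p - 1) * (G m p + L m p) := by
  constructor
  · have hL : L m p * (4*(m:ℝ)+2) = G m p + Rs m p - 1 :=
      div_mul_cancel₀ _ (by positivity)
    have hR : Rs m p = R1 m p + 2*R2 m p + 4*(m:ℝ)*R3 m p := rfl
    simp only [V, Matrix.cons_val]
    linear_combination (G m p + L m p - 1) * hp - hL - hR
  · rw [fderiv_G_add_Rs_apply]
    simp only [V, Matrix.cons_val]
    simp only [G, Rs, R1, R2, R3]
    linear_combination (-2 * L m p) * hp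

end
end

section
/- Each of the following five explicit points lies in ∂𝓔 and is a zero of the Einstein vector field V: P₀ = (1/3, 1/3, 0, √2, √2/3, 0); P_{AC-1} = (1/(4m+3), 1/(4m+3), 1/(4m+3), √2, √2/(4m+3), 2√2/(4m+3)); P_{AC-2} = (1/(4m+3), 1/(4m+3), 1/(4m+3), √2, ((2m+3)/(4m+3))·√((4m+2)/((2m+3)²+2m)), (2/(4m+3))·√((4m+2)/((2m+3)²+2m))); P_{ALC-1} = (0, 1/(4m+2), 1/(4m+2), 0, (1/(4m+2))·√((4m+1)/(2m+2)), (1/(2m+1))·√((4m+1)/(2m+2))); P_{ALC-2} = (0, 1/(4m+2), 1/(4m+2), 0, ((m+1)/(8m+4))·√((8m+2)/((m+1)²+m)), (1/(4m+2))·√((8m+2)/((m+1)²+m))). Moreover, for every real number y₁, the point P_{AH}(y₁) = (1/(4m+3), 1/(4m+3), 1/(4m+3), y₁, 0, 0) satisfies X₁+2X₂+4m·X₃ = 1, V(P_{AH}(y₁)) = 0, and G + R_s = 1/(4m+3) < 1 at P_{AH}(y₁). -/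
open Real Set Filter

noncomputable section

/-- The critical point `P₀`. -/
def P0 : Fin 6 → ℝ := ![1/3, 1/3, 0, Real.sqrt 2, Real.sqrt 2/3, 0]

/-- The critical point `P_{AC-1}`. -/
def PAC1 (m : ℕ) : Fin 6 → ℝ :=
  ![1/(4*(m:ℝ)+3), 1/(4*(m:ℝ)+3), 1/(4*(m:ℝ)+3), Real.sqrt 2,
    Real.sqrt 2/(4*(m:ℝ)+3), 2*Real.sqrt 2/(4*(m:ℝ)+3)]

/-- The critical point `P_{AC-2}`. -/
def PAC2 (m : ℕ) : Fin 6 → ℝ :=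
  ![1/(4*(m:ℝ)+3), 1/(4*(m:ℝ)+3), 1/(4*(m:ℝ)+3), Real.sqrt 2,
    ((2*(m:ℝ)+3)/(4*(m:ℝ)+3)) * Real.sqrt ((4*(m:ℝ)+2)/((2*(m:ℝ)+3)^2+2*(m:ℝ))),
    (2/(4*(m:ℝ)+3)) * Real.sqrt ((4*(m:ℝ)+2)/((2*(m:ℝ)+3)^2+2*(m:ℝ)))]

/-- The critical point `P_{ALC-1}`. -/
def PALC1 (m : ℕ) : Fin 6 → ℝ :=
  ![0, 1/(4*(m:ℝ)+2), 1/(4*(m:ℝ)+2), 0,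
    (1/(4*(m:ℝ)+2)) * Real.sqrt ((4*(m:ℝ)+1)/(2*(m:ℝ)+2)),
    (1/(2*(m:ℝ)+1)) * Real.sqrt ((4*(m:ℝ)+1)/(2*(m:ℝ)+2))]

/-- The critical point `P_{ALC-2}`. -/
def PALC2 (m : ℕ) : Fin 6 → ℝ :=
  ![0, 1/(4*(m:ℝ)+2), 1/(4*(m:ℝ)+2), 0,
    (((m:ℝ)+1)/(8*(m:ℝ)+4)) * Real.sqrt ((8*(m:ℝ)+2)/(((m:ℝ)+1)^2+(m:ℝ))),
    (1/(4*(m:ℝ)+2)) * Real.sqrt ((8*(m:ℝ)+2)/(((m:ℝ)+1)^2+(m:ℝ)))]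

/-- The point `P_{AH}(y₁)`. -/
def PAH (m : ℕ) (y₁ : ℝ) : Fin 6 → ℝ :=
  ![1/(4*(m:ℝ)+3), 1/(4*(m:ℝ)+3), 1/(4*(m:ℝ)+3), y₁, 0, 0]

/-- On the hyperplane `X₁ + 2X₂ + 4m X₃ = 1`, the relations `Rᵢ = Xᵢ(1 - G)` force `G + R_s = 1`,
hence `L = 0`, so together with the relations for the `Yᵢ` they give a zero of `V` in `∂𝓔`. -/
lemma mem_bdryE_and_V_eq_zero {m : ℕ} {p : Fin 6 → ℝ}
    (hX : p 0 + 2 * p 1 + 4 * (m : ℝ) * p 2 = 1)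
    (h1 : R1 m p = p 0 * (1 - G m p)) (h2 : R2 m p = p 1 * (1 - G m p))
    (h3 : R3 m p = p 2 * (1 - G m p)) (h4 : p 3 * (p 0 - p 1) = 0)
    (h5 : p 4 * (G m p - p 1) = 0) (h6 : p 5 * (G m p + p 1 - 2 * p 2) = 0) :
    p ∈ bdryE m ∧ V m p = 0 := by
  have hs : G m p + Rs m p = 1 := by
    rw [Rs]
    linear_combination h1 + 2 * h2 + 4 * (m : ℝ) * h3 + (1 - G m p) * hX
  have hL : L m p = 0 := by rw [L, hs, sub_self, zero_div]
  refine ⟨⟨hX, hs⟩, ?_⟩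
  simp only [V, hL, add_zero, sub_zero, h1, h2, h3, h4, h5, h6]
  funext i
  fin_cases i <;> simp <;> ring

/-- Criterion for a zero of `V` in `∂𝓔` with `Y₁ = y`, `Y₂ = a s`, `Y₃ = b s`, in terms of the
squares `c = y²` and `q = s²`. -/
lemma vec_mem_bdryE_and_V_eq_zero {m : ℕ} {x₁ x₂ x₃ y a b s c q g : ℝ}
    (hc : y ^ 2 = c) (hq : s ^ 2 = q) (hg : x₁ ^ 2 + 2 * x₂ ^ 2 + 4 * (m : ℝ) * x₃ ^ 2 = g)
    (hX : x₁ + 2 * x₂ + 4 * (m : ℝ) * x₃ = 1)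
    (h1 : (c * a ^ 2 / 2 + m * c * b ^ 2 / 4) * q = x₁ * (1 - g))
    (h2 : (2 * a ^ 2 - c * a ^ 2 / 2 + m * b ^ 2 / 2) * q = x₂ * (1 - g))
    (h3 : ((m + 2) * a * b - c * b ^ 2 / 8 - b ^ 2 / 2) * q = x₃ * (1 - g))
    (h4 : y * (x₁ - x₂) = 0) (h5 : a * (g - x₂) = 0) (h6 : b * (g + x₂ - 2 * x₃) = 0) :
    ![x₁, x₂, x₃, y, a * s, b * s] ∈ bdryE m ∧ V m ![x₁, x₂, x₃, y, a * s, b * s] = 0 := by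
  subst hc hq
  have hG : G m ![x₁, x₂, x₃, y, a * s, b * s] = g := hg
  refine mem_bdryE_and_V_eq_zero hX ?_ ?_ ?_ h4 ?_ ?_ <;> rw [hG]
  · change 1 / 2 * y ^ 2 * (a * s) ^ 2 + (m : ℝ) / 4 * y ^ 2 * (b * s) ^ 2 = x₁ * (1 - g)
    linear_combination h1
  · change 2 * (a * s) ^ 2 - 1 / 2 * y ^ 2 * (a * s) ^ 2 + (m : ℝ) / 2 * (b * s) ^ 2
      = x₂ * (1 - g)
    linear_combination h2
  · change ((m : ℝ) + 2) * (a * s) * (b * s) - 1 / 8 * y ^ 2 * (b * s) ^ 2 - 1 / 2 * (b * s) ^ 2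
      = x₃ * (1 - g)
    linear_combination h3
  · change a * s * (g - x₂) = 0
    linear_combination s * h5
  · change b * s * (g + x₂ - 2 * x₃) = 0
    linear_combination s * h6

lemma P0_mem_bdryE_and_V_eq_zero (m : ℕ) : P0 ∈ bdryE m ∧ V m P0 = 0 := by
  have h : P0 = ![1 / 3, 1 / 3, 0, √2, 1 / 3 * √2, 0 * √2] := by
    rw [P0, zero_mul, one_div_mul_eq_div]
  rw [h]
  have hc : √(2 : ℝ) ^ 2 = 2 := Real.sq_sqrt zero_le_two
  apply vec_mem_bdryE_and_V_eq_zero hc hc (g := 1 / 3) <;> ring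

lemma PAC1_mem_bdryE_and_V_eq_zero (m : ℕ) : PAC1 m ∈ bdryE m ∧ V m (PAC1 m) = 0 := by
  have h : PAC1 m = ![1 / (4 * (m : ℝ) + 3), 1 / (4 * (m : ℝ) + 3), 1 / (4 * (m : ℝ) + 3), √2,
      1 / (4 * (m : ℝ) + 3) * √2, 2 / (4 * (m : ℝ) + 3) * √2] := by
    rw [PAC1, one_div_mul_eq_div, div_mul_eq_mul_div]
  rw [h]
  have hc : √(2 : ℝ) ^ 2 = 2 := Real.sq_sqrt zero_le_two
  apply vec_mem_bdryE_and_V_eq_zero hc hc (g := 1 / (4 * (m : ℝ) + 3)) <;> field_simp <;> ring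

lemma PAC2_mem_bdryE_and_V_eq_zero (m : ℕ) : PAC2 m ∈ bdryE m ∧ V m (PAC2 m) = 0 := by
  apply vec_mem_bdryE_and_V_eq_zero (Real.sq_sqrt zero_le_two) (Real.sq_sqrt (by positivity))
    (g := 1 / (4 * (m : ℝ) + 3)) <;> field_simp <;> ring

lemma PALC1_mem_bdryE_and_V_eq_zero (m : ℕ) : PALC1 m ∈ bdryE m ∧ V m (PALC1 m) = 0 := by
  apply vec_mem_bdryE_and_V_eq_zero (zero_pow two_ne_zero) (Real.sq_sqrt (by positivity))
    (g := 1 / (4 * (m : ℝ) + 2)) <;> field_simp <;> ring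

lemma PALC2_mem_bdryE_and_V_eq_zero (m : ℕ) : PALC2 m ∈ bdryE m ∧ V m (PALC2 m) = 0 := by
  apply vec_mem_bdryE_and_V_eq_zero (zero_pow two_ne_zero) (Real.sq_sqrt (by positivity))
    (g := 1 / (4 * (m : ℝ) + 2)) <;> field_simp <;> ring

lemma G_PAH (m : ℕ) (y : ℝ) : G m (PAH m y) = 1 / (4 * (m : ℝ) + 3) := by
  simp [G, PAH]
  field_simp
  ring

lemma Rs_PAH (m : ℕ) (y : ℝ) : Rs m (PAH m y) = 0 := by
  simp [Rs, R1, R2, R3, PAH]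

lemma V_PAH (m : ℕ) (y : ℝ) : V m (PAH m y) = 0 := by
  have hL : L m (PAH m y) = -(1 / (4 * (m : ℝ) + 3)) := by
    rw [L, G_PAH, Rs_PAH]
    field_simp
    ring
  funext i
  fin_cases i <;> simp only [V, hL, G_PAH] <;> simp [R1, R2, R3, PAH]

theorem stmt1 (m : ℕ) (hm : 1 ≤ m) :
    (P0 ∈ bdryE m ∧ V m P0 = 0) ∧
    (PAC1 m ∈ bdryE m ∧ V m (PAC1 m) = 0) ∧
    (PAC2 m ∈ bdryE m ∧ V m (PAC2 m) = 0) ∧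
    (PALC1 m ∈ bdryE m ∧ V m (PALC1 m) = 0) ∧
    (PALC2 m ∈ bdryE m ∧ V m (PALC2 m) = 0) ∧
    (∀ y₁ : ℝ,
      PAH m y₁ 0 + 2 * PAH m y₁ 1 + 4*(m:ℝ) * PAH m y₁ 2 = 1 ∧
      V m (PAH m y₁) = 0 ∧
      G m (PAH m y₁) + Rs m (PAH m y₁) = 1/(4*(m:ℝ)+3) ∧
      (1:ℝ)/(4*(m:ℝ)+3) < 1) := by
  refine ⟨P0_mem_bdryE_and_V_eq_zero m, PAC1_mem_bdryE_and_V_eq_zero m,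
    PAC2_mem_bdryE_and_V_eq_zero m, PALC1_mem_bdryE_and_V_eq_zero m,
    PALC2_mem_bdryE_and_V_eq_zero m, fun y₁ ↦ ⟨?_, V_PAH m y₁, ?_, ?_⟩⟩
  · simp [PAH]
    field_simp
    ring
  · rw [G_PAH, Rs_PAH, add_zero]
  · rw [div_lt_one (by positivity)]
    have : (1 : ℝ) ≤ m := by exact_mod_cast hm
    linarith

end
end

section
/- The set ∂𝓔 is invariant under the flow of the Einstein vector field: if c : I → ℝ⁶ is a solution of c'(η) = V(c(η)) on an interval I and c(η₀) ∈ ∂𝓔 for some η₀ ∈ I, then c(η) ∈ ∂𝓔 for every η ∈ I. -/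
open Real Set Filter

noncomputable section

/-- A solution of a linear scalar equation `f' = a f` with continuous coefficient on an interval
vanishes identically if it vanishes at one point. -/
lemma eq_zero_of_hasDerivWithinAt_mul {I : Set ℝ} (hI : I.OrdConnected) {f a : ℝ → ℝ}
    (ha : ContinuousOn a I) (hf : ∀ t ∈ I, HasDerivWithinAt f (a t * f t) I t)
    {t₀ : ℝ} (ht₀ : t₀ ∈ I) (h0 : f t₀ = 0) : ∀ t ∈ I, f t = 0 := by
  intro t ht
  have hsub : uIcc t₀ t ⊆ I := hI.uIcc_subset ht₀ ht
  obtain ⟨K, hK⟩ := isCompact_uIcc.exists_bound_of_continuousOn (ha.mono hsub)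
  have hLip : ∀ s ∈ uIcc t₀ t, LipschitzOnWith K.toNNReal (fun x => a s * x) univ := by
    intro s hs
    refine LipschitzOnWith.of_dist_le_mul fun x _ y _ => ?_
    rw [Real.dist_eq, Real.dist_eq, ← mul_sub, abs_mul]
    exact mul_le_mul_of_nonneg_right ((hK s hs).trans (Real.le_coe_toNNReal K)) (abs_nonneg _)
  have hcont : ContinuousOn f (uIcc t₀ t) := fun s hs =>
    (hf s (hsub hs)).continuousWithinAt.mono hsub
  rcases le_total t₀ t with h | h
  · rw [uIcc_of_le h] at hsub hLip hcont
    refine ODE_solution_unique_of_mem_Icc_right (v := fun s x => a s * x) (s := fun _ => univ)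
      (g := fun _ => 0) (fun s hs => hLip s (Ico_subset_Icc_self hs)) hcont (fun s hs => ?_)
      (fun _ _ => mem_univ _) continuousOn_const (fun s _ => ?_) (fun _ _ => mem_univ _) h0
      (right_mem_Icc.2 h)
    · exact (hf s (hsub (Ico_subset_Icc_self hs))).mono_of_mem_nhdsWithin
        (mem_of_superset (Icc_mem_nhdsGE_of_mem hs) hsub)
    · simpa using hasDerivWithinAt_const s (Ici s) (0 : ℝ)
  · rw [uIcc_of_ge h] at hsub hLip hcont
    refine ODE_solution_unique_of_mem_Icc_left (v := fun s x => a s * x) (s := fun _ => univ)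
      (g := fun _ => 0) (fun s hs => hLip s (Ioc_subset_Icc_self hs)) hcont (fun s hs => ?_)
      (fun _ _ => mem_univ _) continuousOn_const (fun s _ => ?_) (fun _ _ => mem_univ _) h0
      (left_mem_Icc.2 h)
    · exact (hf s (hsub (Ioc_subset_Icc_self hs))).mono_of_mem_nhdsWithin
        (mem_of_superset (Icc_mem_nhdsLE_of_mem hs) hsub)
    · simpa using hasDerivWithinAt_const s (Iic s) (0 : ℝ)

lemma continuous_G (m : ℕ) : Continuous (G m) := by
  unfold G
  fun_prop

lemma continuous_L (m : ℕ) : Continuous (L m) := by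
  unfold L G Rs R1 R2 R3
  fun_prop

lemma IsSolution.continuousOn {m : ℕ} {I : Set ℝ} {c : ℝ → Fin 6 → ℝ} (hc : IsSolution m I c) :
    ContinuousOn c I :=
  fun η hη => (hc η hη).continuousWithinAt

/-- Along a solution, `H = X₁ + 2X₂ + 4m X₃` satisfies `(H - 1)' = (G + L - 1)(H - 1)`. -/
lemma IsSolution.hasDerivWithinAt_trace {m : ℕ} {I : Set ℝ} {c : ℝ → Fin 6 → ℝ}
    (hc : IsSolution m I c) {η : ℝ} (hη : η ∈ I) :
    HasDerivWithinAt (fun t => c t 0 + 2 * c t 1 + 4 * (m : ℝ) * c t 2 - 1)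
      ((G m (c η) + L m (c η) - 1) * (c η 0 + 2 * c η 1 + 4 * (m : ℝ) * c η 2 - 1)) I η := by
  have h := hasDerivWithinAt_pi.1 (hc η hη)
  have hL : (4 * (m : ℝ) + 2) * L m (c η) = G m (c η) + Rs m (c η) - 1 :=
    mul_div_cancel₀ _ (by positivity)
  refine ((((h 0).add ((h 1).const_mul 2)).add
    ((h 2).const_mul (4 * (m : ℝ)))).sub_const 1).congr_deriv ?_
  simp only [V, Matrix.cons_val]
  unfold Rs at hL
  linear_combination -hL

/-- Along a solution, `Q = G + R_s - 1` satisfies `Q' = 2(G + L - (H - 1)/(4m + 2)) Q`, where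
`H = X₁ + 2X₂ + 4m X₃`. -/
lemma IsSolution.hasDerivWithinAt_energy {m : ℕ} {I : Set ℝ} {c : ℝ → Fin 6 → ℝ}
    (hc : IsSolution m I c) {η : ℝ} (hη : η ∈ I) :
    HasDerivWithinAt (fun t => G m (c t) + Rs m (c t) - 1)
      (2 * (G m (c η) + L m (c η) -
        (c η 0 + 2 * c η 1 + 4 * (m : ℝ) * c η 2 - 1) / (4 * (m : ℝ) + 2)) *
        (G m (c η) + Rs m (c η) - 1)) I η := by
  have h := hasDerivWithinAt_pi.1 (hc η hη)
  have hG : HasDerivWithinAt (fun t => G m (c t)) (2 * (c η 0 * V m (c η) 0 +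
      2 * (c η 1 * V m (c η) 1) + 4 * (m : ℝ) * (c η 2 * V m (c η) 2))) I η := by
    unfold G
    refine ((((h 0).pow 2).add (((h 1).pow 2).const_mul 2)).add
      (((h 2).pow 2).const_mul (4 * (m : ℝ)))).congr_deriv ?_
    norm_num
    ring
  have hYY := ((h 3).mul (h 4)).pow 2
  have hYZ := ((h 3).mul (h 5)).pow 2
  have hRs : HasDerivWithinAt (fun t => Rs m (c t))
      (-(1 / 2) * (2 * (c η 3 * c η 4) * (V m (c η) 3 * c η 4 + c η 3 * V m (c η) 4)) -
        (m : ℝ) / 4 * (2 * (c η 3 * c η 5) * (V m (c η) 3 * c η 5 + c η 3 * V m (c η) 5)) +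
        8 * (c η 4 * V m (c η) 4) +
        4 * (m : ℝ) * ((m : ℝ) + 2) * (V m (c η) 4 * c η 5 + c η 4 * V m (c η) 5) -
        2 * (m : ℝ) * (c η 5 * V m (c η) 5)) I η := by
    have hfun : (fun t => Rs m (c t)) = fun t => -(1 / 2) * (c t 3 * c t 4) ^ 2 -
        (m : ℝ) / 4 * (c t 3 * c t 5) ^ 2 + 4 * (c t 4) ^ 2 - (m : ℝ) * (c t 5) ^ 2 +
        4 * (m : ℝ) * ((m : ℝ) + 2) * (c t 4 * c t 5) := by
      funext t
      unfold Rs R1 R2 R3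
      ring
    rw [hfun]
    refine (((((hYY.const_mul (-(1 / 2))).sub (hYZ.const_mul ((m : ℝ) / 4))).add
      (((h 4).pow 2).const_mul 4)).sub (((h 5).pow 2).const_mul (m : ℝ))).add
      (((h 4).mul (h 5)).const_mul (4 * (m : ℝ) * ((m : ℝ) + 2)))).congr_deriv ?_
    norm_num
    ring
  refine ((hG.add hRs).sub_const 1).congr_deriv ?_
  have hquot : (c η 0 + 2 * c η 1 + 4 * (m : ℝ) * c η 2 - 1) / (4 * (m : ℝ) + 2) *
      (G m (c η) + Rs m (c η) - 1) =
      (c η 0 + 2 * c η 1 + 4 * (m : ℝ) * c η 2 - 1) * L m (c η) := by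
    unfold L
    ring
  rw [mul_assoc (2 : ℝ) (_ - _), sub_mul, hquot]
  simp only [V, Matrix.cons_val]
  generalize L m (c η) = l
  unfold G Rs R1 R2 R3
  ring

theorem stmt2 (m : ℕ) (hm : 1 ≤ m) (I : Set ℝ) (hI : I.OrdConnected)
    (c : ℝ → Fin 6 → ℝ) (hc : IsSolution m I c)
    (η₀ : ℝ) (hη₀ : η₀ ∈ I) (h0 : c η₀ ∈ bdryE m) :
    ∀ η ∈ I, c η ∈ bdryE m := by
  have hcont : ContinuousOn c I := hc.continuousOn
  have hG : ContinuousOn (fun t => G m (c t)) I := (continuous_G m).comp_continuousOn hcont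
  have hL : ContinuousOn (fun t => L m (c t)) I := (continuous_L m).comp_continuousOn hcont
  have hH : ContinuousOn (fun t => c t 0 + 2 * c t 1 + 4 * (m : ℝ) * c t 2 - 1) I :=
    fun t ht => (hc.hasDerivWithinAt_trace ht).continuousWithinAt
  intro η hη
  constructor
  · exact sub_eq_zero.1 (eq_zero_of_hasDerivWithinAt_mul hI ((hG.add hL).sub continuousOn_const)
      (fun t ht => hc.hasDerivWithinAt_trace ht) hη₀ (sub_eq_zero.2 h0.1) η hη)
  · exact sub_eq_zero.1 (eq_zero_of_hasDerivWithinAt_mul hI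
      (continuousOn_const.mul ((hG.add hL).sub (hH.div_const _)))
      (fun t ht => hc.hasDerivWithinAt_energy ht) hη₀ (sub_eq_zero.2 h0.2) η hη)

end
end

section
/- The set 𝓢 = 𝓔 ∩ 𝓟 ∩ 𝓐₁ ∩ 𝓐₂ is a compact subset of ℝ⁶. -/
open Real Set Filter

noncomputable section

theorem isClosed_setS (m : ℕ) : IsClosed (setS m) := by
  simp only [setS, setE, setP, setA1, setA2, G, Rs, R1, R2, R3]
  refine IsClosed.inter (IsClosed.inter (IsClosed.inter ?_ ?_) ?_) ?_ <;>
  repeat' apply IsClosed.and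
  all_goals first
    | exact isClosed_le (by fun_prop) (by fun_prop)
    | exact isClosed_eq (by fun_prop) (by fun_prop)

/-- The scalar curvature term dominates `3Y₂²` where `Y₁² ≤ 2` and `0 ≤ Y₃ ≤ 2Y₂`. -/
theorem three_mul_sq_le_Rs {m : ℕ} {p : Fin 6 → ℝ} (h1 : (p 3)^2 ≤ 2)
    (h3 : 0 ≤ p 5) (h23 : 0 ≤ 2*p 4 - p 5) : 3*(p 4)^2 ≤ Rs m p := by
  have hm : (0:ℝ) ≤ m := m.cast_nonneg
  have hbc : 0 ≤ p 4 * p 5 := mul_nonneg (by linarith) h3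
  have e : Rs m p - 3*(p 4)^2 = (2 - (p 3)^2)/2*(p 4)^2 + (m:ℝ)*(2 - (p 3)^2)/4*(p 5)^2
      + 3/2*((m:ℝ)*(p 5*(2*p 4 - p 5))) + (4*(m:ℝ)^2 + 5*m)*(p 4*p 5) := by
    simp only [Rs, R1, R2, R3]; ring
  have h : 0 ≤ 2 - (p 3)^2 := by linarith
  have : 0 ≤ Rs m p - 3*(p 4)^2 := by rw [e]; positivity
  linarith

theorem setS_subset_Icc {m : ℕ} (hm : 1 ≤ m) :
    setS m ⊆ Set.Icc (fun _ => (-2:ℝ)) (fun _ => 2) := by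
  rintro p ⟨⟨⟨⟨-, hE⟩, -, -, h3⟩, -, h1⟩, h23, -, -, -⟩
  have hR := three_mul_sq_le_Rs (m := m) h1 h3 h23
  have hm' : (1:ℝ) ≤ m := by exact_mod_cast hm
  have hX3 : (p 2)^2 ≤ (m:ℝ)*(p 2)^2 := le_mul_of_one_le_left (sq_nonneg _) hm'
  simp only [G] at hE
  have hX := sq_nonneg (p 0)
  have hX2 := sq_nonneg (p 1)
  have hX3' := sq_nonneg (p 2)
  have hY2 := sq_nonneg (p 4)
  have hb : p 4 ≤ 1 := by nlinarith
  have h : ∀ i, |p i| ≤ 2 := by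
    intro i
    by_cases hi : i = 5
    · subst hi
      exact abs_le.2 ⟨by linarith, by linarith⟩
    · refine abs_le_of_sq_le_sq ?_ (by norm_num)
      fin_cases i <;> simp at hi ⊢ <;> linarith
  exact ⟨fun i => (abs_le.1 (h i)).1, fun i => (abs_le.1 (h i)).2⟩

theorem stmt4 (m : ℕ) (hm : 1 ≤ m) : IsCompact (setS m) :=
  isCompact_Icc.of_isClosed_subset (isClosed_setS m) (setS_subset_Icc hm)

end
end

section
/- If a point p = (X₁, X₂, X₃, Y₁, Y₂, Y₃) belongs to 𝓢 and satisfies (√2/2)(2Y₂ − Y₃) + X₃ − X₂ = 0, then √2/4 + ((m−1)/2)·Y₃ − Y₂ + (1/8)·Y₁²·(2Y₂ + Y₃) ≥ 0. -/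
open Real Set Filter

noncomputable section

/-- The `m = 1` case in the rescaled variables `Y₂ = √2 u`, `Y₃ = √2 v`, with `a = Y₁²`:
if the inequality fails, then `G + R_s > 1`. -/
lemma one_lt_of_neg {x₁ x₂ x₃ a u v : ℝ} (ha₀ : 0 ≤ a) (ha₂ : a ≤ 2) (hu : 0 ≤ u) (hv : 0 ≤ v)
    (hvu : v ≤ 2 * u) (hx₃ : 0 ≤ x₃) (heq : x₂ = 2 * u - v + x₃)
    (hneg : 1 / 4 - u + a * (2 * u + v) / 8 < 0) :
    1 < x₁ ^ 2 + 2 * x₂ ^ 2 + 4 * x₃ ^ 2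
      + (8 * u ^ 2 - 2 * v ^ 2 + 24 * u * v - a * (2 * u ^ 2 + v ^ 2) / 2) := by
  have hau : 0 ≤ a * u := mul_nonneg ha₀ hu
  have hav : 0 ≤ a * v := mul_nonneg ha₀ hv
  have hu4 : 1 / 4 < u := by linarith
  have hsq : 1 / 2 < u * (8 * u - a * u) := by nlinarith
  have hvv : v * v ≤ v * (2 * u) := mul_le_mul_of_nonneg_left hvu hv
  have havv : a * (v * v) ≤ 2 * (v * v) := mul_le_mul_of_nonneg_right ha₂ (mul_self_nonneg v)
  have huv : v * (1 / 4) ≤ v * u := mul_le_mul_of_nonneg_left hu4.le hv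
  have hx₂ : 1 / 2 - 2 * v ≤ 2 * x₂ ^ 2 := by nlinarith [sq_nonneg (x₂ - 1 / 2)]
  nlinarith [sq_nonneg x₁, sq_nonneg x₃]

theorem stmt5 (m : ℕ) (hm : 1 ≤ m) (p : Fin 6 → ℝ) (hp : p ∈ setS m)
    (heq : (Real.sqrt 2/2)*(2*p 4 - p 5) + p 2 - p 1 = 0) :
    0 ≤ Real.sqrt 2/4 + (((m:ℝ)-1)/2)*p 5 - p 4 + (1/8)*(p 3)^2*(2*p 4 + p 5) := by
  obtain ⟨⟨⟨⟨-, hE⟩, hY₁, hY₂, hY₃⟩, -, hY₁'⟩, hY, -, hX₂, hX₃⟩ := hp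
  have hs : √2 * √2 = 2 := Real.mul_self_sqrt (by norm_num)
  have hs₀ : 0 < √2 := by positivity
  have ha : 0 ≤ (p 3) ^ 2 * (2 * p 4 + p 5) := by positivity
  rcases hm.eq_or_lt with rfl | hm
  · by_contra! hneg
    obtain ⟨u, hu⟩ : ∃ u, p 4 = √2 * u := ⟨√2 / 2 * p 4, by linear_combination (-p 4 / 2) * hs⟩
    obtain ⟨v, hv⟩ : ∃ v, p 5 = √2 * v := ⟨√2 / 2 * p 5, by linear_combination (-p 5 / 2) * hs⟩
    simp only [G, Rs, R1, R2, R3, Nat.cast_one] at hE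
    rw [hu, hv] at hE hY heq hneg
    rw [hu] at hY₂
    rw [hv] at hY₃
    have hu₀ : 0 ≤ u := nonneg_of_mul_nonneg_right hY₂ hs₀
    have hv₀ : 0 ≤ v := nonneg_of_mul_nonneg_right hY₃ hs₀
    have hvu : 0 ≤ 2 * u - v :=
      nonneg_of_mul_nonneg_right (by linarith : 0 ≤ √2 * (2 * u - v)) hs₀
    have hneg' : 1 / 4 - u + (p 3) ^ 2 * (2 * u + v) / 8 < 0 := by
      refine neg_of_mul_neg_right (?_ : √2 * _ < 0) hs₀.le
      simp only [Nat.cast_one] at hneg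
      linarith
    have key := one_lt_of_neg (x₁ := p 0) (x₂ := p 1) (sq_nonneg (p 3)) hY₁' hu₀ hv₀
      (by linarith) hX₃ (by linear_combination (u - v / 2) * hs - heq) hneg'
    refine absurd hE (not_le.mpr (key.trans_eq ?_))
    linear_combination (-(4 * u ^ 2 - v ^ 2 + 12 * u * v
      - (p 3) ^ 2 * (2 * u ^ 2 + v ^ 2) / 4)) * hs
  · have hm₂ : (2 : ℝ) ≤ m := by exact_mod_cast hm
    have hmY : 0 ≤ ((m : ℝ) - 2) * p 5 := mul_nonneg (by linarith) hY₃
    have hw : 2 * p 4 - p 5 ≤ √2 / 2 := by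
      have : √2 * (2 * p 4 - p 5) ≤ √2 * (√2 / 2) := by linarith
      exact le_of_mul_le_mul_left this hs₀
    linarith

end
end

section
/- Let c : [0, ∞) → ℝ⁶ be a solution of c'(η) = V(c(η)) with c(η) ∈ 𝓢 for all η ≥ 0. If X₁(c(0)) > 0, X₂(c(0)) > 0 and X₃(c(0)) > 0, then X₁(c(η)) > 0, X₂(c(η)) > 0 and X₃(c(η)) > 0 for all η ≥ 0. -/
open Real Set Filter

noncomputable section

theorem pos_of_mul_le_deriv {x x' a : ℝ → ℝ}
    (hx : ∀ t ∈ Set.Ici (0:ℝ), HasDerivWithinAt x (x' t) (Set.Ici 0) t)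
    (ha : ContinuousOn a (Set.Ici 0))
    (hle : ∀ t ∈ Set.Ici (0:ℝ), a t * x t ≤ x' t) (h0 : 0 < x 0) :
    ∀ t ∈ Set.Ici (0:ℝ), 0 < x t := by
  have hb : Continuous fun t => a (max t 0) :=
    ha.comp_continuous (by fun_prop) fun t => le_max_right t 0
  set A : ℝ → ℝ := fun t => ∫ s in (0:ℝ)..t, a (max s 0)
  have hA : ∀ t, HasDerivAt A (a (max t 0)) t := fun t =>
    intervalIntegral.integral_hasDerivAt_right (hb.intervalIntegrable 0 t)
      (hb.stronglyMeasurableAtFilter _ _) hb.continuousAt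
  have hmono : MonotoneOn (fun t => x t * Real.exp (-A t)) (Set.Ici 0) := by
    refine monotoneOn_of_hasDerivWithinAt_nonneg (convex_Ici 0)
      (f' := fun t => x' t * Real.exp (-A t) + x t * (Real.exp (-A t) * -a (max t 0))) ?_ ?_ ?_
    · intro t ht
      exact (hx t ht).continuousWithinAt.mul (hA t).neg.exp.continuousAt.continuousWithinAt
    · intro t ht
      exact ((hx t (interior_subset ht)).mono interior_subset).mul
        (hA t).neg.exp.hasDerivWithinAt
    · intro t ht
      have ht : t ∈ Set.Ici (0:ℝ) := interior_subset ht
      have h := mul_nonneg (sub_nonneg.2 (hle t ht)) (Real.exp_pos (-A t)).le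
      rw [max_eq_left ht]
      linarith
  intro t ht
  have h := hmono Set.self_mem_Ici ht ht
  exact pos_of_mul_pos_left ((mul_pos h0 (Real.exp_pos _)).trans_le h) (Real.exp_pos _).le

theorem L_nonpos_of_mem_setS {m : ℕ} {p : Fin 6 → ℝ} (hp : p ∈ setS m) : L m p ≤ 0 :=
  div_nonpos_of_nonpos_of_nonneg (by linarith [hp.1.1.1.2]) (by positivity)

theorem R1_nonneg (m : ℕ) (p : Fin 6 → ℝ) : 0 ≤ R1 m p := by
  unfold R1
  positivity

theorem R2_nonneg_of_mem_setS {m : ℕ} {p : Fin 6 → ℝ} (hp : p ∈ setS m) : 0 ≤ R2 m p := by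
  have h1 := mul_nonneg (sub_nonneg.2 hp.1.2.2) (sq_nonneg (p 4))
  have h2 : 0 ≤ (m:ℝ) / 2 * p 5 ^ 2 := by positivity
  unfold R2
  nlinarith [sq_nonneg (p 4)]

theorem R3_nonneg_of_mem_setS {m : ℕ} {p : Fin 6 → ℝ} (hp : p ∈ setS m) : 0 ≤ R3 m p := by
  obtain ⟨⟨⟨_, _, h4, h5⟩, _, h3⟩, h, _⟩ := hp
  have e1 := mul_nonneg (sub_nonneg.2 h3) (sq_nonneg (p 5))
  have e2 := mul_nonneg h h5
  have e3 := mul_nonneg h4 h5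
  have e4 := mul_nonneg (Nat.cast_nonneg (α := ℝ) m) e3
  unfold R3
  nlinarith

theorem stmt8 (m : ℕ) (hm : 1 ≤ m) (c : ℝ → Fin 6 → ℝ)
    (hc : IsSolution m (Set.Ici 0) c)
    (hS : ∀ η ∈ Set.Ici (0:ℝ), c η ∈ setS m)
    (h1 : 0 < c 0 0) (h2 : 0 < c 0 1) (h3 : 0 < c 0 2) :
    ∀ η ∈ Set.Ici (0:ℝ), 0 < c η 0 ∧ 0 < c η 1 ∧ 0 < c η 2 := by
  have hcont : ContinuousOn c (Set.Ici 0) := fun t ht => (hc t ht).continuousWithinAt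
  have ha : ContinuousOn (fun t => G m (c t) + L m (c t) - 1) (Set.Ici 0) := by
    have h : Continuous fun p : Fin 6 → ℝ => G m p + L m p - 1 := by
      unfold L Rs R1 R2 R3 G
      fun_prop
    exact h.comp_continuousOn hcont
  have hd := fun i t ht => hasDerivWithinAt_pi.1 (hc t ht) i
  intro t ht
  refine ⟨pos_of_mul_le_deriv (hd 0) ha ?_ h1 t ht, pos_of_mul_le_deriv (hd 1) ha ?_ h2 t ht,
    pos_of_mul_le_deriv (hd 2) ha ?_ h3 t ht⟩ <;>
  · intro s hs
    have hL := L_nonpos_of_mem_setS (hS s hs)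
    have hR1 := R1_nonneg m (c s)
    have hR2 := R2_nonneg_of_mem_setS (hS s hs)
    have hR3 := R3_nonneg_of_mem_setS (hS s hs)
    simp only [V, Matrix.cons_val]
    linarith

end
end

section
/- Let m ≥ 1 be an integer and let X₁, X₂, X₃ be real numbers with X₁ + 2X₂ + 4m·X₃ = 1, 0 ≤ X₁ ≤ X₂, and X₃ ≥ 0. Then X₁ ≤ 1/3 and X₁² + 2X₂² + 4m·X₃² ≤ (3/2)X₁² − X₁ + 1/2 ≤ 1/2. -/
open Real Set Filter

noncomputable section

theorem stmt9 (m : ℕ) (hm : 1 ≤ m) (X₁ X₂ X₃ : ℝ)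
    (h : X₁ + 2*X₂ + 4*(m:ℝ)*X₃ = 1) (h0 : 0 ≤ X₁) (h12 : X₁ ≤ X₂) (h3 : 0 ≤ X₃) :
    X₁ ≤ 1/3 ∧
    X₁^2 + 2*X₂^2 + 4*(m:ℝ)*X₃^2 ≤ (3/2)*X₁^2 - X₁ + 1/2 ∧
    (3/2)*X₁^2 - X₁ + 1/2 ≤ 1/2 := by
  have hm' : (1:ℝ) ≤ m := by exact_mod_cast hm
  have hmX₃ : 0 ≤ (m:ℝ)*X₃ := by positivity
  have hX₁ : X₁ ≤ 1/3 := by linarith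
  refine ⟨hX₁, ?_, by nlinarith⟩
  have hcross : 0 ≤ (m:ℝ)*X₃*X₂ := mul_nonneg hmX₃ (h0.trans h12)
  have hsq : 0 ≤ ((m:ℝ) - 1)*((m:ℝ)*X₃^2) :=
    mul_nonneg (sub_nonneg.2 hm') (by positivity)
  have hpos : 0 ≤ (m:ℝ)*X₃^2 := by positivity
  obtain rfl : X₁ = 1 - 2*X₂ - 4*(m:ℝ)*X₃ := by linarith
  nlinarith

end
end

section
/- For every point p = (X₁, X₂, X₃, Y₁, Y₂, Y₃) in 𝓢 one has: R₁(p) ≥ 0, R₂(p) ≥ 0, R₃(p) ≥ 0, G(p) ≥ 1/(4m+3), and consequently (1 − G(p) − R_s(p))/(4m+2) ≤ 1/(4m+3) and G(p) + L(p) ≥ 0. -/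
open Real Set Filter

noncomputable section

theorem stmt10 (m : ℕ) (hm : 1 ≤ m) (p : Fin 6 → ℝ) (hp : p ∈ setS m) :
    0 ≤ R1 m p ∧ 0 ≤ R2 m p ∧ 0 ≤ R3 m p ∧
    1/(4*(m:ℝ)+3) ≤ G m p ∧
    (1 - G m p - Rs m p)/(4*(m:ℝ)+2) ≤ 1/(4*(m:ℝ)+3) ∧
    0 ≤ G m p + L m p := by
  obtain ⟨⟨⟨⟨hE, -⟩, -, h4, h5⟩, -, h3⟩, h45, -⟩ := hp
  have hm' : (1 : ℝ) ≤ m := by exact_mod_cast hm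
  have hR1 : 0 ≤ R1 m p := by unfold R1; positivity
  have hR2 : 0 ≤ R2 m p := by
    have h : 0 ≤ (2 - (p 3)^2) * (p 4)^2 := mul_nonneg (by linarith) (sq_nonneg _)
    have h' : 0 ≤ (m : ℝ) * (p 5)^2 := by positivity
    unfold R2
    nlinarith [sq_nonneg (p 4)]
  have hR3 : 0 ≤ R3 m p := by
    have h : 0 ≤ (2 - (p 3)^2) * (p 5)^2 := mul_nonneg (by linarith) (sq_nonneg _)
    have h' : 0 ≤ ((m : ℝ) - 1) * (p 4 * p 5) :=
      mul_nonneg (by linarith) (mul_nonneg h4 h5)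
    have h'' : 0 ≤ (2 * p 4 - p 5) * p 5 := mul_nonneg h45 h5
    unfold R3
    nlinarith [sq_nonneg (p 5)]
  have hRs : 0 ≤ Rs m p := by unfold Rs; positivity
  have hG : 1 ≤ (4 * (m : ℝ) + 3) * G m p := by
    have h : (4 * (m : ℝ) + 3) * G m p =
        (p 0 + 2 * p 1 + 4 * (m : ℝ) * p 2)^2 + 2 * (p 0 - p 1)^2
          + 4 * (m : ℝ) * (p 0 - p 2)^2 + 8 * (m : ℝ) * (p 1 - p 2)^2 := by
      unfold G; ring
    rw [h, hE]
    have : 0 ≤ 2 * (p 0 - p 1)^2 + 4 * (m : ℝ) * (p 0 - p 2)^2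
        + 8 * (m : ℝ) * (p 1 - p 2)^2 := by positivity
    linarith
  have hG' : 1 / (4 * (m : ℝ) + 3) ≤ G m p := by
    rw [div_le_iff₀ (by positivity)]
    linarith
  refine ⟨hR1, hR2, hR3, hG', ?_, ?_⟩
  · rw [div_le_iff₀ (by positivity)]
    have h : 1 / (4 * (m : ℝ) + 3) * (4 * (m : ℝ) + 2) = 1 - 1 / (4 * (m : ℝ) + 3) := by
      field_simp
      ring
    linarith
  · have h : G m p + L m p =
        ((4 * (m : ℝ) + 3) * G m p + Rs m p - 1) / (4 * (m : ℝ) + 2) := by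
      unfold L
      field_simp
      ring
    rw [h]
    exact div_nonneg (by linarith) (by positivity)

end
end

section
/- Let c : [0, ∞) → ℝ⁶ be a solution of c'(η) = V(c(η)) with c(η) ∈ 𝓢 for all η ≥ 0 and with G(c(0)) + R_s(c(0)) < 1. Then there exists y₁ ∈ [0, √2] such that c(η) converges, as η → ∞, to the point P_{AH}(y₁) = (1/(4m+3), 1/(4m+3), 1/(4m+3), y₁, 0, 0). -/
open Real Set Filter

noncomputable section

/-- An antitone criterion on `[0, ∞)` in terms of one-sided derivatives. -/
theorem antitoneOn_Ici_of_hasDerivWithinAt_nonpos {f f' : ℝ → ℝ}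
    (hf : ∀ t ∈ Ici (0:ℝ), HasDerivWithinAt f (f' t) (Ici 0) t)
    (hf' : ∀ t ∈ Ici (0:ℝ), f' t ≤ 0) : AntitoneOn f (Ici 0) :=
  antitoneOn_of_hasDerivWithinAt_nonpos (convex_Ici 0)
    (fun t ht => (hf t ht).continuousWithinAt)
    (fun t ht => (hf t (interior_subset ht)).mono interior_subset)
    (fun t ht => hf' t (interior_subset ht))

/-- If `X₁ + 2X₂ + 4m X₃ = 1` then `G - 1/(4m+3)` is the weighted sum of the squares of the
deviations `Xᵢ - 1/(4m+3)`. -/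
theorem G_sub_eq_sum_sq (m : ℕ) {p : Fin 6 → ℝ} (hp : p 0 + 2*p 1 + 4*(m:ℝ)*p 2 = 1) :
    G m p - 1/(4*(m:ℝ)+3) = (p 0 - 1/(4*(m:ℝ)+3))^2 + 2*(p 1 - 1/(4*(m:ℝ)+3))^2
      + 4*(m:ℝ)*(p 2 - 1/(4*(m:ℝ)+3))^2 := by
  have hn : (1/(4*(m:ℝ)+3)) * (4*(m:ℝ)+3) = 1 := by field_simp
  unfold G
  linear_combination (2/(4*(m:ℝ)+3)) * hp - (1/(4*(m:ℝ)+3)) * hn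

/-- On `𝓢` the scalar curvature term controls `Y₂²`. -/
theorem two_mul_sq_le_Rs {m : ℕ} (hm : 1 ≤ m) {p : Fin 6 → ℝ} (hp : p ∈ setS m) :
    2*(p 4)^2 ≤ Rs m p := by
  obtain ⟨⟨⟨-, -, -, hy3⟩, -, hy1⟩, hy23, -⟩ := hp
  have hM : (1:ℝ) ≤ m := by exact_mod_cast hm
  have h1 : 0 ≤ R1 m p := by unfold R1; positivity
  have h2 : (p 4)^2 ≤ R2 m p := by
    have : 0 ≤ (m:ℝ) * (p 5)^2 := by positivity
    unfold R2
    nlinarith [mul_le_mul_of_nonneg_right hy1 (sq_nonneg (p 4))]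
  have h3 : 0 ≤ R3 m p := by
    have hY : 0 ≤ (p 5) * (2 * p 4 - p 5) := mul_nonneg hy3 hy23
    unfold R3
    nlinarith [mul_le_mul_of_nonneg_right hy1 (sq_nonneg (p 5)),
      mul_nonneg (by linarith : (0:ℝ) ≤ (m:ℝ) + 2) hY,
      mul_nonneg (by linarith : (0:ℝ) ≤ (m:ℝ) - 1) (sq_nonneg (p 5)), sq_nonneg (p 5)]
  have h4 : 0 ≤ 4 * (m:ℝ) * R3 m p := by positivity
  unfold Rs
  linarith

/-- The identity `(4m+2)(L + 1/(4m+3)) = (G - 1/(4m+3)) + R_s`. -/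
theorem L_add_mul_eq (m : ℕ) (p : Fin 6 → ℝ) :
    (4*(m:ℝ)+2) * (L m p + 1/(4*(m:ℝ)+3)) = (G m p - 1/(4*(m:ℝ)+3)) + Rs m p := by
  unfold L
  field_simp
  ring

/-- Along a solution with `X₁ + 2X₂ + 4m X₃ = 1`, one has `L' = 2(G + L)L`. -/
theorem hasDerivWithinAt_L {m : ℕ} {c : ℝ → Fin 6 → ℝ} {s : Set ℝ} {t : ℝ}
    (hc : HasDerivWithinAt c (V m (c t)) s t)
    (ht : c t 0 + 2*c t 1 + 4*(m:ℝ)*c t 2 = 1) :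
    HasDerivWithinAt (fun η => L m (c η))
      (2 * (G m (c t) + L m (c t)) * L m (c t)) s t := by
  have h := hasDerivWithinAt_pi.1 hc
  have h3 := (h 3).pow 2
  have h4 := (h 4).pow 2
  have h5 := (h 5).pow 2
  have hG := (((h 0).pow 2).add (((h 1).pow 2).const_mul 2)).add
    (((h 2).pow 2).const_mul (4*(m:ℝ)))
  have hR1 := ((h3.const_mul (1/2)).mul h4).add ((h3.const_mul ((m:ℝ)/4)).mul h5)
  have hR2 := ((h4.const_mul 2).sub ((h3.const_mul (1/2)).mul h4)).add
    (h5.const_mul ((m:ℝ)/2))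
  have hR3 := ((((h 4).const_mul ((m:ℝ)+2)).mul (h 5)).sub
    ((h3.const_mul (1/8)).mul h5)).sub (h5.const_mul (1/2))
  have hRs := (hR1.add (hR2.const_mul 2)).add (hR3.const_mul (4*(m:ℝ)))
  refine (((hG.add hRs).sub_const 1).div_const (4*(m:ℝ)+2)).congr_deriv ?_
  have hL : G m (c t) + Rs m (c t) - 1 = L m (c t) * (4*(m:ℝ)+2) := by
    unfold L
    field_simp
  rw [div_eq_iff (by positivity), mul_assoc (2 * _), ← hL]
  simp only [V, Matrix.cons_val, Rs]
  have hGv : G m (c t) = (c t 0)^2 + 2*(c t 1)^2 + 4*(m:ℝ)*(c t 2)^2 := rfl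
  generalize L m (c t) = l
  generalize G m (c t) = g at *
  simp only [R1, R2, R3, Pi.pow_apply]
  linear_combination (-2 * l) * ht - 2 * (g + l - 1) * hGv

/-- On `𝓢` the quantity `L` is at least `-1/(4m+3)`. -/
theorem L_add_nonneg {m : ℕ} (hm : 1 ≤ m) {p : Fin 6 → ℝ} (hp : p ∈ setS m) :
    0 ≤ L m p + 1/(4*(m:ℝ)+3) := by
  have hR := two_mul_sq_le_Rs hm hp
  have hG := G_sub_eq_sum_sq m hp.1.1.1.1
  have : 0 ≤ (4*(m:ℝ)+2) * (L m p + 1/(4*(m:ℝ)+3)) := by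
    rw [L_add_mul_eq, hG]
    have := (mul_nonneg zero_le_two (sq_nonneg (p 4))).trans hR
    positivity
  exact nonneg_of_mul_nonneg_right this (by positivity)

/-- Every solution in `𝓢` starting off the boundary `G + R_s = 1` has `L → -1/(4m+3)`. -/
theorem tendsto_L_add {m : ℕ} (hm : 1 ≤ m) {c : ℝ → Fin 6 → ℝ}
    (hc : IsSolution m (Ici 0) c) (hS : ∀ η ∈ Ici (0:ℝ), c η ∈ setS m)
    (h0 : G m (c 0) + Rs m (c 0) < 1) :
    Tendsto (fun η => L m (c η) + 1/(4*(m:ℝ)+3)) atTop (nhds 0) := by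
  set n : ℝ := 4*(m:ℝ)+3
  have hL := fun t (ht : t ∈ Ici (0:ℝ)) => hasDerivWithinAt_L (hc t ht) (hS t ht).1.1.1.1
  have hw := fun t (ht : t ∈ Ici (0:ℝ)) => L_add_nonneg hm (hS t ht)
  have hG : ∀ t ∈ Ici (0:ℝ), 1/n ≤ G m (c t) := fun t ht => by
    have := G_sub_eq_sum_sq m (hS t ht).1.1.1.1
    rw [← sub_nonneg, this]
    positivity
  have hneg : ∀ t ∈ Ici (0:ℝ), L m (c t) ≤ 0 := fun t ht =>
    div_nonpos_of_nonpos_of_nonneg (by linarith [(hS t ht).1.1.1.2]) (by positivity)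
  have hL0 : L m (c 0) < 0 := div_neg_of_neg_of_pos (by linarith) (by positivity)
  have hanti : AntitoneOn (fun η => L m (c η)) (Ici 0) :=
    antitoneOn_Ici_of_hasDerivWithinAt_nonpos hL fun t ht =>
      mul_nonpos_of_nonneg_of_nonpos (by linarith [hw t ht, hG t ht]) (hneg t ht)
  set k : ℝ := -(2 * L m (c 0))
  have hk : 0 < k := by simp only [k]; linarith
  have hexp : ∀ t : ℝ, HasDerivAt (fun η => exp (k * η)) (exp (k * t) * k) t := fun t => by
    simpa using ((hasDerivAt_id t).const_mul k).exp
  have hE : AntitoneOn (fun η => (L m (c η) + 1/n) * exp (k * η)) (Ici 0) := by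
    refine antitoneOn_Ici_of_hasDerivWithinAt_nonpos
      (fun t ht => ((hL t ht).add_const (1/n)).mul (hexp t).hasDerivWithinAt) fun t ht => ?_
    have hle : L m (c t) ≤ L m (c 0) := hanti self_mem_Ici ht ht
    have hd : 2 * (G m (c t) + L m (c t)) * L m (c t) + (L m (c t) + 1/n) * k ≤ 0 := by
      simp only [k]
      nlinarith [hw t ht, hG t ht]
    nlinarith [mul_nonpos_of_nonpos_of_nonneg hd (exp_pos (k * t)).le]
  have hlim : Tendsto (fun η => (L m (c 0) + 1/n) * exp (-(k * η))) atTop (nhds 0) := by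
    simpa using (tendsto_exp_neg_atTop_nhds_zero.comp
      (tendsto_id.const_mul_atTop hk)).const_mul (L m (c 0) + 1/n)
  refine tendsto_of_tendsto_of_tendsto_of_le_of_le' tendsto_const_nhds hlim
    ((eventually_ge_atTop 0).mono hw) ((eventually_ge_atTop 0).mono fun t ht => ?_)
  have := hE self_mem_Ici ht ht
  rw [exp_neg, ← div_eq_mul_inv, le_div_iff₀ (exp_pos _)]
  simpa using this

/-- A function whose square of the distance to `a` is eventually dominated by a function tending
to `0` converges to `a`. -/
theorem tendsto_of_sub_sq_le {f g : ℝ → ℝ} {a : ℝ} (hg : Tendsto g atTop (nhds 0))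
    (h : ∀ᶠ t in atTop, (f t - a)^2 ≤ g t) : Tendsto f atTop (nhds a) := by
  have hsq : Tendsto (fun t => (f t - a)^2) atTop (nhds 0) :=
    squeeze_zero' (.of_forall fun t => sq_nonneg _) h hg
  have := hsq.sqrt
  simp only [sqrt_sq_eq_abs, sqrt_zero] at this
  exact tendsto_sub_nhds_zero_iff.1 ((tendsto_zero_iff_abs_tendsto_zero _).2 this)

/-- An antitone function on `[0, ∞)` that is bounded below converges. -/
theorem exists_tendsto_of_antitoneOn_Ici {f : ℝ → ℝ} {a : ℝ} (hf : AntitoneOn f (Ici 0))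
    (ha : ∀ t ∈ Ici (0:ℝ), a ≤ f t) : ∃ l, Tendsto f atTop (nhds l) := by
  have hanti : Antitone fun t => f (max t 0) := fun s t hst =>
    hf (le_max_right s 0) (le_max_right t 0) (max_le_max_right 0 hst)
  refine ⟨_, (tendsto_atTop_ciInf hanti ⟨a, ?_⟩).congr' ?_⟩
  · rintro _ ⟨t, rfl⟩
    exact ha _ (le_max_right t 0)
  · filter_upwards [eventually_ge_atTop 0] with t ht
    rw [max_eq_left ht]

theorem stmt13 (m : ℕ) (hm : 1 ≤ m) (c : ℝ → Fin 6 → ℝ)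
    (hc : IsSolution m (Set.Ici 0) c)
    (hS : ∀ η ∈ Set.Ici (0:ℝ), c η ∈ setS m)
    (h0 : G m (c 0) + Rs m (c 0) < 1) :
    ∃ y₁ ∈ Set.Icc (0:ℝ) (Real.sqrt 2),
      Filter.Tendsto c Filter.atTop
        (nhds ![1/(4*(m:ℝ)+3), 1/(4*(m:ℝ)+3), 1/(4*(m:ℝ)+3), y₁, 0, 0]) := by
  set n : ℝ := 4*(m:ℝ)+3
  have hM : (1:ℝ) ≤ m := by exact_mod_cast hm
  have hdev : Tendsto (fun η => (4*(m:ℝ)+2) * (L m (c η) + 1/n)) atTop (nhds 0) := by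
    simpa using (tendsto_L_add hm hc hS h0).const_mul (4*(m:ℝ)+2)
  have key : ∀ t ∈ Ici (0:ℝ), (c t 0 - 1/n)^2 + 2*(c t 1 - 1/n)^2 + 4*(m:ℝ)*(c t 2 - 1/n)^2
      + 2*(c t 4)^2 ≤ (4*(m:ℝ)+2) * (L m (c t) + 1/n) := fun t ht => by
    rw [L_add_mul_eq, G_sub_eq_sum_sq m (hS t ht).1.1.1.1]
    linarith [two_mul_sq_le_Rs hm (hS t ht)]
  have hsq : ∀ t, (c t 2 - 1/n)^2 ≤ 4*(m:ℝ)*(c t 2 - 1/n)^2 := fun t =>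
    le_mul_of_one_le_left (sq_nonneg _) (by linarith)
  have hX1 : Tendsto (fun η => c η 0) atTop (nhds (1/n)) :=
    tendsto_of_sub_sq_le hdev <| (eventually_ge_atTop 0).mono fun t ht => by
      linarith [key t ht, hsq t, sq_nonneg (c t 1 - 1/n), sq_nonneg (c t 2 - 1/n),
        sq_nonneg (c t 4)]
  have hX2 : Tendsto (fun η => c η 1) atTop (nhds (1/n)) :=
    tendsto_of_sub_sq_le hdev <| (eventually_ge_atTop 0).mono fun t ht => by
      linarith [key t ht, hsq t, sq_nonneg (c t 0 - 1/n), sq_nonneg (c t 1 - 1/n),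
        sq_nonneg (c t 2 - 1/n), sq_nonneg (c t 4)]
  have hX3 : Tendsto (fun η => c η 2) atTop (nhds (1/n)) :=
    tendsto_of_sub_sq_le hdev <| (eventually_ge_atTop 0).mono fun t ht => by
      linarith [key t ht, hsq t, sq_nonneg (c t 0 - 1/n), sq_nonneg (c t 1 - 1/n),
        sq_nonneg (c t 4)]
  have hY2 : Tendsto (fun η => c η 4) atTop (nhds 0) :=
    tendsto_of_sub_sq_le hdev <| (eventually_ge_atTop 0).mono fun t ht => by
      rw [sub_zero]
      linarith [key t ht, hsq t, sq_nonneg (c t 0 - 1/n), sq_nonneg (c t 1 - 1/n),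
        sq_nonneg (c t 2 - 1/n), sq_nonneg (c t 4)]
  have hY3 : Tendsto (fun η => c η 5) atTop (nhds 0) :=
    squeeze_zero' ((eventually_ge_atTop 0).mono fun t ht => (hS t ht).1.1.2.2.2)
      ((eventually_ge_atTop 0).mono fun t ht => sub_nonneg.1 (hS t ht).2.1)
      (by simpa using hY2.const_mul 2)
  have hY1anti : AntitoneOn (fun η => c η 3) (Ici 0) :=
    antitoneOn_Ici_of_hasDerivWithinAt_nonpos
      (fun t ht => hasDerivWithinAt_pi.1 (hc t ht) 3) fun t ht =>
        mul_nonpos_of_nonneg_of_nonpos (hS t ht).1.1.2.1 (sub_nonpos.2 (hS t ht).1.2.1)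
  obtain ⟨y, hy⟩ := exists_tendsto_of_antitoneOn_Ici hY1anti fun t ht => (hS t ht).1.1.2.1
  refine ⟨y, isClosed_Icc.mem_of_tendsto hy ((eventually_ge_atTop 0).mono fun t ht =>
    ⟨(hS t ht).1.1.2.1, le_sqrt_of_sq_le (hS t ht).1.2.2⟩), tendsto_pi_nhds.2 fun i => ?_⟩
  fin_cases i
  exacts [hX1, hX2, hX3, hy, hY2, hY3]

end
end

section
/- The set 𝓑_{Rd} = 𝓔 ∩ 𝓟 ∩ {p : X₁ = X₂ and Y₁² = 2} is forward flow-invariant for the Einstein vector field: if c : I → ℝ⁶ is a solution of c'(η) = V(c(η)) on an interval I, η₀, η₁ ∈ I with η₀ ≤ η₁, and c(η₀) ∈ 𝓑_{Rd}, then c(η₁) ∈ 𝓑_{Rd}. -/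
open Real Set Filter

noncomputable section

theorem eq_zero_of_linear_ode_pair {u w g k h : ℝ → ℝ} {a b : ℝ}
    (hg : ContinuousOn g (Icc a b)) (hk : ContinuousOn k (Icc a b))
    (hh : ContinuousOn h (Icc a b))
    (hu : ∀ t ∈ Icc a b, HasDerivWithinAt u (g t * u t + k t * w t) (Icc a b) t)
    (hw : ∀ t ∈ Icc a b, HasDerivWithinAt w (h t * u t) (Icc a b) t)
    (hu0 : u a = 0) (hw0 : w a = 0) : ∀ t ∈ Icc a b, u t = 0 ∧ w t = 0 := by
  obtain ⟨A, hA⟩ := isCompact_Icc.exists_bound_of_continuousOn hg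
  obtain ⟨B, hB⟩ := isCompact_Icc.exists_bound_of_continuousOn hk
  obtain ⟨C, hC⟩ := isCompact_Icc.exists_bound_of_continuousOn hh
  have hd : ∀ t ∈ Icc a b, HasDerivWithinAt (fun t => (u t, w t))
      (g t * u t + k t * w t, h t * u t) (Icc a b) t :=
    fun t ht => (hu t ht).prodMk (hw t ht)
  have key := eq_zero_of_abs_deriv_le_mul_abs_self_of_eq_zero_right
    (f := fun t => (u t, w t)) (f' := fun t => (g t * u t + k t * w t, h t * u t))
    (K := A + B + C) (a := a) (b := b)
    (fun t ht => (hd t ht).continuousWithinAt)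
    (fun t ht => (hd t (Ico_subset_Icc_self ht)).mono_of_mem_nhdsWithin
      (Icc_mem_nhdsGE_of_mem ht))
    (by simp [hu0, hw0]) ?_
  · intro t ht
    simpa [Prod.ext_iff] using key t ht
  · intro t ht
    have ht' := Ico_subset_Icc_self ht
    have hu' : ‖u t‖ ≤ ‖(u t, w t)‖ := le_max_left _ _
    have hw' : ‖w t‖ ≤ ‖(u t, w t)‖ := le_max_right _ _
    set N := ‖(u t, w t)‖
    have hN : 0 ≤ N := norm_nonneg _
    have h1 : ‖g t * u t‖ ≤ A * N := norm_mul_le_of_le (hA t ht') hu'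
    have h2 : ‖k t * w t‖ ≤ B * N := norm_mul_le_of_le (hB t ht') hw'
    have h3 : ‖h t * u t‖ ≤ C * N := norm_mul_le_of_le (hC t ht') hu'
    have p1 := norm_nonneg (g t * u t)
    have p2 := norm_nonneg (k t * w t)
    have p3 := norm_nonneg (h t * u t)
    refine max_le ((norm_add_le _ _).trans ?_) ?_
    · linarith
    · change ‖h t * u t‖ ≤ _
      linarith

theorem eq_zero_of_linear_ode {u g : ℝ → ℝ} {a b : ℝ} (hg : ContinuousOn g (Icc a b))
    (hu : ∀ t ∈ Icc a b, HasDerivWithinAt u (g t * u t) (Icc a b) t) (hu0 : u a = 0) :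
    ∀ t ∈ Icc a b, u t = 0 := fun t ht =>
  (eq_zero_of_linear_ode_pair (w := fun _ => 0) (k := fun _ => 0) (h := fun _ => 0) hg
    continuousOn_const continuousOn_const (fun t ht => by simpa using hu t ht)
    (fun t _ => by simpa using hasDerivWithinAt_const t (Icc a b) (0 : ℝ)) hu0 rfl t ht).1

theorem nonneg_of_linear_ode {u g : ℝ → ℝ} {a b : ℝ} (hg : ContinuousOn g (Icc a b))
    (hu : ∀ t ∈ Icc a b, HasDerivWithinAt u (g t * u t) (Icc a b) t) (hu0 : 0 ≤ u a) :
    ∀ t ∈ Icc a b, 0 ≤ u t := by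
  intro t ht
  by_contra! hneg
  have hsub : Icc a t ⊆ Icc a b := Icc_subset_Icc_right ht.2
  obtain ⟨s, hs, hs0⟩ := intermediate_value_Icc' ht.1
    (fun x hx => ((hu x (hsub hx)).continuousWithinAt.mono hsub)) ⟨hneg.le, hu0⟩
  have hsub' : Icc s t ⊆ Icc a b := Icc_subset_Icc hs.1 ht.2
  have := eq_zero_of_linear_ode (hg.mono hsub') (fun x hx => (hu x (hsub' hx)).mono hsub') hs0
    t (right_mem_Icc.2 hs.2)
  exact hneg.ne this

theorem stmt14 (m : ℕ) (hm : 1 ≤ m) (I : Set ℝ) (hI : I.OrdConnected)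
    (c : ℝ → Fin 6 → ℝ) (hc : IsSolution m I c)
    (η₀ η₁ : ℝ) (hη₀ : η₀ ∈ I) (hη₁ : η₁ ∈ I) (hle : η₀ ≤ η₁)
    (h0 : c η₀ ∈ setE m ∩ setP ∩ {p | p 0 = p 1 ∧ (p 3)^2 = 2}) :
    c η₁ ∈ setE m ∩ setP ∩ {p | p 0 = p 1 ∧ (p 3)^2 = 2} := by
  have hsub : Icc η₀ η₁ ⊆ I := hI.out hη₀ hη₁
  have hη : η₁ ∈ Icc η₀ η₁ := right_mem_Icc.2 hle
  have hd : ∀ t ∈ Icc η₀ η₁, ∀ i,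
      HasDerivWithinAt (fun s => c s i) (V m (c t) i) (Icc η₀ η₁) t := fun t ht i =>
    hasDerivWithinAt_pi.1 ((hc t (hsub ht)).mono hsub) i
  have hcont : ContinuousOn c (Icc η₀ η₁) := fun t ht =>
    ((hc t (hsub ht)).mono hsub).continuousWithinAt
  have hcomp : ∀ {f : (Fin 6 → ℝ) → ℝ}, Continuous f →
      ContinuousOn (fun t => f (c t)) (Icc η₀ η₁) := fun hf => hf.comp_continuousOn hcont
  have hG : Continuous (G m) := by unfold G; fun_prop
  have hL : Continuous (L m) := by unfold L Rs R1 R2 R3 G; fun_prop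
  have hm' : (4 * (m : ℝ) + 2) ≠ 0 := by positivity
  obtain ⟨⟨⟨hS0, hQ0⟩, hY1, hY2, hY3⟩, hX, hY⟩ := h0
  have hS := eq_zero_of_linear_ode (a := η₀) (b := η₁)
    (u := fun t => c t 0 + 2 * c t 1 + 4 * (m : ℝ) * c t 2 - 1)
    (g := fun t => G m (c t) + L m (c t) - 1)
    (hcomp (f := fun p => G m p + L m p - 1) (by fun_prop))
    (fun t ht => by
      refine (((((hd t ht 0).add ((hd t ht 1).const_mul 2)).add
        ((hd t ht 2).const_mul (4 * (m : ℝ)))).sub_const 1)).congr_deriv ?_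
      simp [V]
      simp only [L, Rs]
      field_simp
      ring)
    (by linarith)
  have hQ := nonneg_of_linear_ode (a := η₀) (b := η₁)
    (u := fun t => 1 - (G m (c t) + Rs m (c t)))
    (g := fun t => 2 * (G m (c t) + L m (c t)))
    (hcomp (f := fun p => 2 * (G m p + L m p)) (by fun_prop))
    (fun t ht => by
      have d := hd t ht
      have hR1 : HasDerivWithinAt (fun s => R1 m (c s)) _ (Icc η₀ η₁) t :=
        ((((d 3).fun_pow 2).const_mul (1/2)).mul ((d 4).fun_pow 2)).add
          ((((d 3).fun_pow 2).const_mul ((m:ℝ)/4)).mul ((d 5).fun_pow 2))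
      have hR2 : HasDerivWithinAt (fun s => R2 m (c s)) _ (Icc η₀ η₁) t :=
        ((((d 4).fun_pow 2).const_mul 2).sub
          ((((d 3).fun_pow 2).const_mul (1/2)).mul ((d 4).fun_pow 2))).add
          (((d 5).fun_pow 2).const_mul ((m:ℝ)/2))
      have hR3 : HasDerivWithinAt (fun s => R3 m (c s)) _ (Icc η₀ η₁) t :=
        ((((d 4).const_mul ((m:ℝ)+2)).mul (d 5)).sub
          ((((d 3).fun_pow 2).const_mul (1/8)).mul ((d 5).fun_pow 2))).sub
          (((d 5).fun_pow 2).const_mul (1/2))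
      have hG' : HasDerivWithinAt (fun s => G m (c s)) _ (Icc η₀ η₁) t :=
        (((d 0).fun_pow 2).add (((d 1).fun_pow 2).const_mul 2)).add
          (((d 2).fun_pow 2).const_mul (4*(m:ℝ)))
      have hRs : HasDerivWithinAt (fun s => Rs m (c s)) _ (Icc η₀ η₁) t :=
        (hR1.add (hR2.const_mul 2)).add (hR3.const_mul (4*(m:ℝ)))
      refine ((hG'.add hRs).const_sub 1).congr_deriv ?_
      have hSt : c t 0 = 1 - 2 * c t 1 - 4 * (m : ℝ) * c t 2 := by linarith [hS t ht]
      simp [V]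
      generalize L m (c t) = l
      simp only [Rs, R1, R2, R3, G]
      rw [hSt]
      ring)
    (by simpa using hQ0)
  have hXY := eq_zero_of_linear_ode_pair (a := η₀) (b := η₁)
    (u := fun t => c t 0 - c t 1) (w := fun t => (c t 3) ^ 2 - 2)
    (g := fun t => G m (c t) + L m (c t) - 1)
    (k := fun t => (c t 4) ^ 2 + (m : ℝ) / 4 * (c t 5) ^ 2)
    (h := fun t => 2 * (c t 3) ^ 2)
    (hcomp (f := fun p => G m p + L m p - 1) (by fun_prop))
    (hcomp (f := fun p => (p 4) ^ 2 + (m : ℝ) / 4 * (p 5) ^ 2) (by fun_prop))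
    (hcomp (f := fun p => 2 * (p 3) ^ 2) (by fun_prop))
    (fun t ht => by
      refine ((hd t ht 0).sub (hd t ht 1)).congr_deriv ?_
      simp [V]
      simp only [R1, R2]
      ring)
    (fun t ht => by
      refine (((hd t ht 3).fun_pow 2).sub_const 2).congr_deriv ?_
      simp [V]
      ring)
    (sub_eq_zero.2 hX) (sub_eq_zero.2 hY) η₁ hη
  have hY1' := nonneg_of_linear_ode (u := fun t => c t 3) (g := fun t => c t 0 - c t 1)
    (hcomp (f := fun p => p 0 - p 1) (by fun_prop))
    (fun t ht => (hd t ht 3).congr_deriv (by simp [V]; ring)) hY1 η₁ hη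
  have hY2' := nonneg_of_linear_ode (u := fun t => c t 4)
    (g := fun t => G m (c t) + L m (c t) - c t 1)
    (hcomp (f := fun p => G m p + L m p - p 1) (by fun_prop))
    (fun t ht => (hd t ht 4).congr_deriv (by simp [V]; ring)) hY2 η₁ hη
  have hY3' := nonneg_of_linear_ode (u := fun t => c t 5)
    (g := fun t => G m (c t) + L m (c t) + c t 1 - 2 * c t 2)
    (hcomp (f := fun p => G m p + L m p + p 1 - 2 * p 2) (by fun_prop))
    (fun t ht => (hd t ht 5).congr_deriv (by simp [V]; ring)) hY3 η₁ hη
  exact ⟨⟨⟨sub_eq_zero.1 (hS η₁ hη), sub_nonneg.1 (hQ η₁ hη)⟩, hY1', hY2', hY3'⟩,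
    sub_eq_zero.1 hXY.1, sub_eq_zero.1 hXY.2⟩

end
end
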